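/- Let Δ be a complete simplicial multi-fan of dimension n. For a generic vector v set μ(I) = #{i ∈ I : ⟨u_i^I, v⟩ > 0} and h_k(Δ) = Σ_{I∈Σ^{(n)}, μ(I)=k} w(I). Then the T_y-genus T_y[Δ] = Σ_I (w(I)/|H_I|) Σ_{h∈H_I} ∏_{i∈I} (1 + y χ_I(u_i^I,h)^{-1}t^{-u_i^I})/(1 - χ_I(u_i^I,h)^{-1}t^{-u_i^I}) is a constant (independent of t), equal to Σ_{k=0}^n h_k(Δ)(-y)^k, and moreover h_{n-k}(Δ) = h_k(Δ) for all k. -/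

import Mathlib

open scoped Classical

/-- The part of the `a`-th Laurent coefficient of `(1 + y z⁻¹) / (1 - z⁻¹)` that is common to its
expansions at `z = 0` and at `z = ∞`; the expansion at `∞` has an additional `1 + y`. -/
def laurentOffset {R : Type*} [CommRing R] (y : R) (a : ℤ) : R :=
  if a = 0 then -y else if 0 < a then -(1 + y) else 0

theorem hasSum_laurent_zero (y : ℂ) {z : ℂ} (hz : ‖z‖ < 1) (hz0 : z ≠ 0) :
    HasSum (fun a : ℤ => laurentOffset y a * z ^ a) ((1 + y * z⁻¹) / (1 - z⁻¹)) := by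
  have hz1 : z ≠ 1 := fun h => by simp [h] at hz
  have hz1' : 1 - z ≠ 0 := sub_ne_zero.2 hz1.symm
  have hz1'' : z - 1 ≠ 0 := sub_ne_zero.2 hz1
  have h1 := ((hasSum_geometric_of_norm_lt_one hz).mul_left (-(1 + y))).add
    (hasSum_ite_eq (0 : ℕ) (1 : ℂ))
  have h2 : HasSum (fun n : ℕ => laurentOffset y (-(n + 1 : ℤ)) * z ^ (-(n + 1 : ℤ))) 0 := by
    have h : (fun n : ℕ => laurentOffset y (-(n + 1 : ℤ)) * z ^ (-(n + 1 : ℤ))) = fun _ => 0 := by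
      funext n
      have h1 : ¬ (-(n + 1 : ℤ) = 0) := by omega
      have h2 : ¬ (0 < -(n + 1 : ℤ)) := by omega
      rw [laurentOffset, if_neg h1, if_neg h2, zero_mul]
    rw [h]
    exact hasSum_zero
  have h3 : HasSum (fun n : ℕ => laurentOffset y (n : ℤ) * z ^ (n : ℤ))
      (-(1 + y) * (1 - z)⁻¹ + 1) := by
    refine h1.congr_fun fun n => ?_
    rcases n with _ | n
    · simp [laurentOffset]
    · have : (0 : ℤ) < n + 1 := by omega
      simp [laurentOffset, this, this.ne', ← zpow_natCast]
  have h4 : (1 + y * z⁻¹) / (1 - z⁻¹) = -(1 + y) * (1 - z)⁻¹ + 1 + 0 := by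
    have : 1 - z⁻¹ ≠ 0 := by
      rw [sub_ne_zero]; intro h; exact hz1 (inv_eq_one.1 h.symm)
    field_simp
    ring
  rw [h4]
  exact HasSum.of_nat_of_neg_add_one h3 h2

theorem hasSum_laurent_infty (y : ℂ) {z : ℂ} (hz : 1 < ‖z‖) :
    HasSum (fun a : ℤ => (laurentOffset y a + (1 + y)) * z ^ a)
      ((1 + y * z⁻¹) / (1 - z⁻¹)) := by
  have hz0 : z ≠ 0 := fun h => by simp [h] at hz; linarith
  have hz1 : z ≠ 1 := fun h => by simp [h] at hz
  have hw : ‖z⁻¹‖ < 1 := by rw [norm_inv]; exact inv_lt_one_of_one_lt₀ hz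
  have hw1 : 1 - z⁻¹ ≠ 0 := by
    rw [sub_ne_zero]; intro h; exact hz1 (inv_eq_one.1 h.symm)
  have h1 := (hasSum_geometric_of_norm_lt_one hw).mul_left ((1 + y) * z⁻¹)
  have h2 := hasSum_ite_eq (0 : ℕ) (1 : ℂ)
  convert! HasSum.of_nat_of_neg_add_one (f := fun a : ℤ => (laurentOffset y a + (1 + y)) * z ^ a)
    (m := 1) (m' := (1 + y) * z⁻¹ * (1 - z⁻¹)⁻¹) ?_ ?_ using 1
  · field_simp
    ring
  · convert! h2 using 2 with n
    rcases n with _ | n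
    · simp [laurentOffset]
    · have : (0 : ℤ) < n + 1 := by omega
      simp [laurentOffset, this, this.ne']
  · convert! h1 using 2 with n
    have h3 : ¬ (-(n + 1 : ℤ) = 0) := by omega
    have h4 : ¬ (0 < -(n + 1 : ℤ)) := by omega
    simp only [laurentOffset, if_neg, h3, h4, not_false_iff, zero_add]
    rw [mul_assoc, ← pow_succ', inv_pow, zpow_neg]
    norm_cast

theorem hasSum_laurent (y : ℂ) {χ t : ℂ} (hχ : ‖χ‖ = 1) (ht : 1 < ‖t‖) {m : ℤ} (hm : m ≠ 0) :
    HasSum (fun a : ℤ => (laurentOffset y a + if 0 < m then 1 + y else 0) * (χ * t ^ m) ^ a)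
      ((1 + y * χ⁻¹ * t ^ (-m)) / (1 - χ⁻¹ * t ^ (-m))) := by
  have ht0 : t ≠ 0 := fun h => by simp [h] at ht; linarith
  have hχ0 : χ ≠ 0 := fun h => by simp [h] at hχ
  have hinv : (χ * t ^ m)⁻¹ = χ⁻¹ * t ^ (-m) := by rw [mul_inv, zpow_neg]
  rw [mul_assoc, ← hinv]
  rcases hm.lt_or_gt with h | h
  · simp only [not_lt.2 h.le, if_false, add_zero]
    refine hasSum_laurent_zero y ?_ (mul_ne_zero hχ0 (zpow_ne_zero _ ht0))
    rw [norm_mul, hχ, one_mul, norm_zpow]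
    exact zpow_lt_one_of_neg₀ ht h
  · simp only [h, if_true]
    refine hasSum_laurent_infty y ?_
    rw [norm_mul, hχ, one_mul, norm_zpow]
    exact one_lt_zpow₀ ht h

theorem hasSum_pi_prod {κ : Type*} [Fintype κ] {α : Type*} {f : κ → α → ℂ} {s : κ → ℂ}
    (hf : ∀ i, HasSum (f i) (s i)) :
    HasSum (fun a : κ → α => ∏ i, f i (a i)) (∏ i, s i) := by
  have key : ∀ (n : ℕ) (f : Fin n → α → ℂ) (s : Fin n → ℂ), (∀ i, HasSum (f i) (s i)) →
      HasSum (fun a : Fin n → α => ∏ i, f i (a i)) (∏ i, s i) := by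
    intro n
    induction n with
    | zero =>
      intro f s _
      simp only [Finset.univ_eq_empty, Finset.prod_empty]
      exact hasSum_unique (fun _ : Fin 0 → α => (1 : ℂ))
    | succ n ih =>
      intro f s hf
      have h0 := hf 0
      have h := ih (fun i => f i.succ) (fun i => s i.succ) fun i => hf i.succ
      rw [Fin.prod_univ_succ, ← (Fin.consEquiv fun _ : Fin (n + 1) => α).hasSum_iff]
      have hs := summable_mul_of_summable_norm h0.summable.norm h.summable.norm
      have hm := HasSum.mul h0 h hs
      refine HasSum.congr_fun hm fun a => ?_
      simp [Fin.consEquiv, Fin.prod_univ_succ]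
  have e := (Fintype.equivFin κ).symm
  have h := key _ (fun i => f (e i)) (fun i => s (e i)) fun i => hf (e i)
  rw [← (Equiv.arrowCongr e (Equiv.refl α)).hasSum_iff, ← Equiv.prod_comp e s]
  refine h.congr_fun fun a => ?_
  rw [Function.comp_apply, ← Equiv.prod_comp e]
  simp

/-- The combinatorial wall-crossing identity. -/
theorem sum_prod_add_indep {ι L R : Type*} [Fintype ι] [CommRing R] {n : ℕ}
    {Sn : Finset (Finset ι)} (hcard : ∀ I ∈ Sn, I.card = n) {wt : Finset ι → ℤ}
    {uI : Finset ι → ι → L → ℚ}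
    (hcomplete : ∀ K : Finset ι, (∃ I ∈ Sn, K ⊆ I) →
      ∃ d : ℤ, ∀ x : L, (∀ I ∈ Sn, K ⊆ I → ∀ i ∈ I \ K, uI I i x ≠ 0) →
        ∑ I ∈ Sn.filter (fun I => K ⊆ I ∧ ∀ i ∈ I \ K, 0 < uI I i x), wt I = d)
    (A : ι → R) (B : R) {x x' : L}
    (hx : ∀ I ∈ Sn, ∀ i ∈ I, uI I i x ≠ 0) (hx' : ∀ I ∈ Sn, ∀ i ∈ I, uI I i x' ≠ 0) :
    ∑ I ∈ Sn, (wt I : R) * ∏ i ∈ I, (A i + if 0 < uI I i x then B else 0) =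
      ∑ I ∈ Sn, (wt I : R) * ∏ i ∈ I, (A i + if 0 < uI I i x' then B else 0) := by
  have key : ∀ x : L, ∑ I ∈ Sn, (wt I : R) * ∏ i ∈ I, (A i + if 0 < uI I i x then B else 0) =
      ∑ K : Finset ι, (∏ i ∈ K, A i) * B ^ (n - K.card) *
        ((∑ I ∈ Sn.filter (fun I => K ⊆ I ∧ ∀ i ∈ I \ K, 0 < uI I i x), wt I : ℤ) : R) := by
    intro x
    simp only [Int.cast_sum, Finset.mul_sum, Finset.sum_filter]
    rw [Finset.sum_comm]
    refine Finset.sum_congr rfl fun I hI => ?_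
    rw [Finset.prod_add, Finset.mul_sum, ← Finset.filter_subset_univ, Finset.sum_filter]
    refine Finset.sum_congr rfl fun K _ => ?_
    by_cases hK : K ⊆ I
    · rw [if_pos hK]
      by_cases hp : ∀ i ∈ I \ K, 0 < uI I i x
      · rw [if_pos ⟨hK, hp⟩, Finset.prod_congr rfl fun i hi => if_pos (hp i hi),
          Finset.prod_const, Finset.card_sdiff_of_subset hK, hcard I hI]
        ring
      · rw [if_neg fun h => hp h.2]
        push Not at hp
        obtain ⟨i, hi, hpi⟩ := hp
        rw [Finset.prod_eq_zero hi (if_neg (not_lt.2 hpi))]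
        ring
    · rw [if_neg hK, if_neg fun h => hK h.1, Int.cast_zero, mul_zero]
  rw [key, key]
  refine Finset.sum_congr rfl fun K _ => ?_
  by_cases hK : ∃ I ∈ Sn, K ⊆ I
  · obtain ⟨d, hd⟩ := hcomplete K hK
    rw [hd x fun I hI _ i hi => hx I hI i (Finset.mem_sdiff.1 hi).1,
      hd x' fun I hI _ i hi => hx' I hI i (Finset.mem_sdiff.1 hi).1]
  · have : ∀ x, Sn.filter (fun I => K ⊆ I ∧ ∀ i ∈ I \ K, 0 < uI I i x) = ∅ := fun x =>
      Finset.filter_eq_empty_iff.2 fun I hI h => hK ⟨I, hI, h.1⟩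
    rw [this, this]

section Cone

variable {L : Type*} [AddCommGroup L] {κ : Type*} {b : κ → L}

theorem exists_nsmul_mem_of_finite {S : Submodule ℤ L} [Finite (L ⧸ S)] :
    ∃ N : ℕ, N ≠ 0 ∧ ∀ x : L, N • x ∈ S := by
  refine ⟨Nat.card (L ⧸ S), Nat.card_pos.ne', fun x => ?_⟩
  rw [← Submodule.Quotient.mk_eq_zero, Submodule.Quotient.mk_smul]
  exact card_nsmul_eq_zero'

theorem eq_zero_of_finite_quotient_span [Finite (L ⧸ Submodule.span ℤ (Set.range b))]
    {f : L →ₗ[ℤ] ℚ} (hf : ∀ i, f (b i) = 0) : f = 0 := by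
  obtain ⟨N, hN, h⟩ := exists_nsmul_mem_of_finite (S := Submodule.span ℤ (Set.range b))
  have hle : Submodule.span ℤ (Set.range b) ≤ LinearMap.ker f := by
    rw [Submodule.span_le]
    rintro _ ⟨i, rfl⟩
    exact hf i
  ext x
  have h1 : f (N • x) = 0 := hle (h x)
  rw [map_nsmul, smul_eq_zero] at h1
  exact h1.resolve_left hN

variable {ub : κ → (L →ₗ[ℤ] ℚ)}

theorem dual_expand [Fintype κ] [DecidableEq κ] [Finite (L ⧸ Submodule.span ℤ (Set.range b))]
    (hdual : ∀ i j, ub i (b j) = if i = j then 1 else 0) (f : L →ₗ[ℤ] ℚ) (x : L) :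
    f x = ∑ i, f (b i) * ub i x := by
  have h := eq_zero_of_finite_quotient_span (b := b)
    (f := f - ∑ i, (LinearMap.mulLeft ℤ (f (b i))).comp (ub i)) fun j => by simp [hdual]
  have hx := LinearMap.congr_fun h x
  simpa [sub_eq_zero] using hx

variable {H : Type*} [Fintype H] {vrep : H → L}

theorem finite_quotient_of_bijective
    (hH : Function.Bijective fun h : H =>
      (Submodule.Quotient.mk (vrep h) : L ⧸ Submodule.span ℤ (Set.range b))) :
    Finite (L ⧸ Submodule.span ℤ (Set.range b)) :=
  Finite.of_surjective _ hH.2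

/-- Orthogonality of characters on a finite quotient. -/
theorem sum_exp_eq {S : Submodule ℤ L}
    (hH : Function.Bijective fun h : H => (Submodule.Quotient.mk (vrep h) : L ⧸ S))
    (f : L →ₗ[ℤ] ℚ) (hf : ∀ x ∈ S, ∃ k : ℤ, f x = k) :
    ∑ h, Complex.exp (2 * (Real.pi : ℂ) * Complex.I * (f (vrep h) : ℂ)) =
      if ∀ x, ∃ k : ℤ, f x = k then (Fintype.card H : ℂ) else 0 := by
  have hexp : ∀ q : ℚ, Complex.exp (2 * (Real.pi : ℂ) * Complex.I * (q : ℂ)) = 1 ↔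
      ∃ k : ℤ, q = k := by
    intro q
    rw [Complex.exp_eq_one_iff]
    refine exists_congr fun k => ?_
    rw [mul_comm, mul_left_inj' Complex.two_pi_I_ne_zero]
    norm_cast
  split_ifs with hint
  · rw [Finset.sum_congr rfl fun h _ => (hexp _).2 (hint (vrep h))]
    simp
  · push Not at hint
    obtain ⟨x₀, hx₀⟩ := hint
    set e : L → ℂ := fun x => Complex.exp (2 * (Real.pi : ℂ) * Complex.I * (f x : ℂ)) with he
    have he_add : ∀ x y, e (x + y) = e x * e y := by
      intro x y
      simp only [he, map_add, Rat.cast_add, mul_add, Complex.exp_add]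
    have he_mk : ∀ x y, (Submodule.Quotient.mk x : L ⧸ S) = Submodule.Quotient.mk y →
        e x = e y := by
      intro x y hxy
      have h1 : e (x - y) = 1 := (hexp _).2 (hf _ ((Submodule.Quotient.eq S).1 hxy))
      rw [← sub_add_cancel x y, he_add, h1, one_mul]
    have hx1 : e x₀ ≠ 1 := fun h => by
      obtain ⟨k, hk⟩ := (hexp _).1 h
      exact hx₀ k hk
    have : Finite (L ⧸ S) := Finite.of_surjective _ hH.2
    have := Fintype.ofFinite (L ⧸ S)
    have hmk : ∀ q : L ⧸ S, (Submodule.Quotient.mk q.out : L ⧸ S) = q := fun q =>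
      Quotient.out_eq' q
    have hsum : ∑ h, e (vrep h) = ∑ q : L ⧸ S, e q.out :=
      Fintype.sum_bijective _ hH _ _ fun h => he_mk _ _ (hmk _).symm
    have hshift : ∑ q : L ⧸ S, e q.out = e x₀ * ∑ q : L ⧸ S, e q.out := by
      rw [Finset.mul_sum]
      refine (Equiv.sum_comp (Equiv.addLeft (Submodule.Quotient.mk x₀ : L ⧸ S)) _).symm.trans
        (Finset.sum_congr rfl fun q _ => ?_)
      rw [← he_add]
      refine he_mk _ _ ?_
      rw [hmk, Submodule.Quotient.mk_add, hmk]
      rfl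
    have h0 : (1 - e x₀) * ∑ q : L ⧸ S, e q.out = 0 := by
      rw [sub_mul, one_mul, ← hshift, sub_self]
    exact hsum.trans ((mul_eq_zero.1 h0).resolve_left (sub_ne_zero.2 hx1.symm))

/-- Laurent expansion at `t = ∞` of the contribution of one cone. -/
theorem hasSum_cone [Fintype κ] [DecidableEq κ] (hdual : ∀ i j, ub i (b j) = if i = j then 1 else 0)
    (hH : Function.Bijective fun h : H =>
      (Submodule.Quotient.mk (vrep h) : L ⧸ Submodule.span ℤ (Set.range b)))
    {χ : H → κ → ℂ}
    (hχ : ∀ h i, χ h i =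
      Complex.exp (2 * (Real.pi : ℂ) * Complex.I * ((ub i (vrep h) : ℚ) : ℂ)))
    {x : L} {m : κ → ℤ} (hm : ∀ i, ub i x = m i) (hm0 : ∀ i, m i ≠ 0)
    (y : ℂ) {t : ℂ} (ht : 1 < ‖t‖) :
    HasSum (fun u : L →ₗ[ℤ] ℤ =>
        (∏ i, (laurentOffset y (u (b i)) + if 0 < m i then 1 + y else 0)) * t ^ u x)
      ((Fintype.card H : ℂ)⁻¹ * ∑ h, ∏ i, (1 + y * (χ h i)⁻¹ * t ^ (-m i)) /
        (1 - (χ h i)⁻¹ * t ^ (-m i))) := by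
  have ht0 : t ≠ 0 := fun h => by simp [h] at ht; linarith
  have hfin := finite_quotient_of_bijective hH
  have hnorm : ∀ h i, ‖χ h i‖ = 1 := by
    intro h i
    have : (2 * (Real.pi : ℂ) * Complex.I * ((ub i (vrep h) : ℚ) : ℂ)) =
        ((2 * Real.pi * (ub i (vrep h) : ℚ) : ℝ) : ℂ) * Complex.I := by
      push_cast; ring
    rw [hχ, this, Complex.norm_exp_ofReal_mul_I]
  have hcard : (Fintype.card H : ℂ) ≠ 0 := by
    have : Nonempty H := ⟨(hH.2 0).choose⟩
    exact_mod_cast Fintype.card_ne_zero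
  have h1 := (hasSum_sum (s := Finset.univ) fun (h : H) _ =>
    hasSum_pi_prod fun i => hasSum_laurent y (hnorm h i) ht (hm0 i)).mul_left
      (Fintype.card H : ℂ)⁻¹
  have hexpand := dual_expand hdual
  let ev : (L →ₗ[ℤ] ℤ) → κ → ℤ := fun u i => u (b i)
  have hev : Function.Injective ev := by
    intro u u' huu
    have h2 := eq_zero_of_finite_quotient_span (b := b)
      (f := (Algebra.linearMap ℤ ℚ).comp (u - u')) fun i => by
        have : u (b i) = u' (b i) := congrFun huu i
        simp [this]
    ext z
    have h3 := LinearMap.congr_fun h2 z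
    simpa [sub_eq_zero] using h3
  -- the coefficient at an arbitrary integral point
  have hcoef : ∀ a : κ → ℤ, (Fintype.card H : ℂ)⁻¹ * ∑ h, ∏ i,
      (laurentOffset y (a i) + if 0 < m i then 1 + y else 0) * (χ h i * t ^ m i) ^ a i =
      if ∀ z, ∃ k : ℤ, (∑ i, a i • ub i) z = k then
        (∏ i, (laurentOffset y (a i) + if 0 < m i then 1 + y else 0)) * t ^ (∑ i, a i * m i)
      else 0 := by
    intro a
    have h2 : ∀ h, ∏ i, (laurentOffset y (a i) + if 0 < m i then 1 + y else 0) *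
        (χ h i * t ^ m i) ^ a i =
        ((∏ i, (laurentOffset y (a i) + if 0 < m i then 1 + y else 0)) * t ^ (∑ i, a i * m i)) *
        Complex.exp (2 * (Real.pi : ℂ) * Complex.I * (((∑ i, a i • ub i) (vrep h) : ℚ) : ℂ)) := by
      intro h
      have h3 : Complex.exp (2 * (Real.pi : ℂ) * Complex.I *
          (((∑ i, a i • ub i) (vrep h) : ℚ) : ℂ)) = ∏ i, χ h i ^ a i := by
        simp only [hχ, ← Complex.exp_int_mul, ← Complex.exp_sum]
        congr 1
        simp only [LinearMap.sum_apply, LinearMap.smul_apply, zsmul_eq_mul, Rat.cast_sum,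
          Rat.cast_mul, Rat.cast_intCast, Finset.mul_sum]
        exact Finset.sum_congr rfl fun i _ => by ring
      have h4 : t ^ (∑ i, a i * m i) = ∏ i, (t ^ m i) ^ a i := by
        have : ∀ s : Finset κ, t ^ (∑ i ∈ s, a i * m i) = ∏ i ∈ s, (t ^ m i) ^ a i := by
          intro s
          induction s using Finset.induction_on with
          | empty => simp
          | insert i s hi ih =>
            rw [Finset.sum_insert hi, Finset.prod_insert hi, zpow_add₀ ht0, ih, mul_comm (a i),
              zpow_mul]
        exact this _
      simp only [h3, h4, mul_zpow, Finset.prod_mul_distrib]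
      ring
    rw [Finset.sum_congr rfl fun h _ => h2 h, ← Finset.mul_sum, sum_exp_eq hH]
    · split_ifs
      · field_simp
      · simp
    · intro z hz
      induction hz using Submodule.span_induction with
      | mem z hz =>
        obtain ⟨j, rfl⟩ := hz
        exact ⟨a j, by simp [hdual]⟩
      | zero => exact ⟨0, by simp⟩
      | add z z' _ _ h h' =>
        obtain ⟨k, hk⟩ := h
        obtain ⟨k', hk'⟩ := h'
        exact ⟨k + k', by rw [map_add, hk, hk']; push_cast; rfl⟩
      | smul c z _ h =>
        obtain ⟨k, hk⟩ := h
        exact ⟨c * k, by rw [map_smul, hk]; simp⟩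
  rw [← hev.hasSum_iff (f := fun a : κ → ℤ => (Fintype.card H : ℂ)⁻¹ * ∑ h, ∏ i,
      (laurentOffset y (a i) + if 0 < m i then 1 + y else 0) * (χ h i * t ^ m i) ^ a i)] at h1
  · refine HasSum.congr_fun h1 fun u => ?_
    have h5 : (∑ i, u (b i) • ub i) = (Algebra.linearMap ℤ ℚ).comp u := by
      ext z
      rw [hexpand ((Algebra.linearMap ℤ ℚ).comp u) z]
      simp
    have h6 : u x = ∑ i, u (b i) * m i := by
      have := hexpand ((Algebra.linearMap ℤ ℚ).comp u) x
      simp only [hm] at this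
      simp at this
      exact_mod_cast this
    simp only [Function.comp_apply, hcoef, ev, h5]
    rw [if_pos fun z => ⟨u z, by simp⟩, h6]
  · intro a ha
    rw [hcoef, if_neg]
    intro hint
    choose k hk using hint
    refine ha ⟨{ toFun := k, map_add' := fun z z' => ?_, map_smul' := fun c z => ?_ }, ?_⟩
    · have := map_add (∑ i, a i • ub i) z z'
      rw [hk, hk, hk] at this
      exact_mod_cast this
    · have := map_smul (∑ i, a i • ub i) c z
      rw [hk, hk] at this
      simp at this
      simpa using mod_cast this
    · funext j
      have h7 : (∑ i, a i • ub i) (b j) = a j := by simp [hdual]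
      rw [hk] at h7
      exact_mod_cast h7

end Cone

theorem finite_setOf_pow_eq {k : ℕ} (hk : 0 < k) (a : ℂ) : {t : ℂ | t ^ k = a}.Finite := by
  refine (Polynomial.nthRoots k a).toFinset.finite_toSet.subset fun t ht => ?_
  simpa [Polynomial.mem_nthRoots hk] using ht

theorem finite_setOf_one_sub_zpow_eq_zero {c : ℂ} {m : ℤ} (hm : m ≠ 0) :
    {t : ℂ | 1 - c⁻¹ * t ^ (-m) = 0}.Finite := by
  have hk : 0 < m.natAbs := Int.natAbs_pos.2 hm
  refine ((finite_setOf_pow_eq hk c).union (finite_setOf_pow_eq hk c⁻¹)).subset fun t ht => ?_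
  have ht' : c⁻¹ * t ^ (-m) = 1 := (sub_eq_zero.1 ht).symm
  rcases Int.natAbs_eq m with h | h <;> rw [h] at ht'
  · right
    rw [zpow_neg, zpow_natCast, ← mul_inv, inv_eq_one] at ht'
    exact eq_inv_of_mul_eq_one_right ht'
  · left
    rw [neg_neg, zpow_natCast] at ht'
    have := eq_inv_of_mul_eq_one_right ht'
    rwa [inv_inv] at this

/-- A sum of cone contributions that is constant outside the unit disc is constant. -/
theorem sum_cone_eq_of_one_lt_norm {ι : Type*} {S : Finset (Finset ι)} (w : Finset ι → ℂ)
    {H : Finset ι → Type*} [∀ I, Fintype (H I)] {χ : (I : Finset ι) → H I → ι → ℂ}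
    (hχ : ∀ I ∈ S, ∀ h, ∀ i ∈ I, ‖χ I h i‖ = 1) {m : Finset ι → ι → ℤ}
    (hm : ∀ I ∈ S, ∀ i ∈ I, m I i ≠ 0) (y C : ℂ)
    (hC : ∀ t : ℂ, 1 < ‖t‖ → ∑ I ∈ S, w I * ∑ h : H I, ∏ i ∈ I,
      (1 + y * (χ I h i)⁻¹ * t ^ (-(m I i))) / (1 - (χ I h i)⁻¹ * t ^ (-(m I i))) = C)
    {t : ℂ} (ht : t ≠ 0)
    (hden : ∀ I ∈ S, ∀ h : H I, ∀ i ∈ I, 1 - (χ I h i)⁻¹ * t ^ (-(m I i)) ≠ 0) :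
    ∑ I ∈ S, w I * ∑ h : H I, ∏ i ∈ I,
      (1 + y * (χ I h i)⁻¹ * t ^ (-(m I i))) / (1 - (χ I h i)⁻¹ * t ^ (-(m I i))) = C := by
  set B : Set ℂ := {0} ∪ ⋃ I ∈ S, ⋃ h : H I, ⋃ i ∈ I,
    {t : ℂ | 1 - (χ I h i)⁻¹ * t ^ (-(m I i)) = 0} with hB
  have hmem : ∀ s : ℂ, s ∈ Bᶜ ↔ s ≠ 0 ∧
      ∀ I ∈ S, ∀ h : H I, ∀ i ∈ I, 1 - (χ I h i)⁻¹ * s ^ (-(m I i)) ≠ 0 := by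
    intro s
    simp [hB]
  have hfin : B.Finite := by
    refine (Set.finite_singleton 0).union ?_
    refine S.finite_toSet.biUnion fun I hI => Set.finite_iUnion fun h => ?_
    exact I.finite_toSet.biUnion fun i hi => finite_setOf_one_sub_zpow_eq_zero (hm I hI i hi)
  have hconn : IsPreconnected Bᶜ :=
    (hfin.countable.isPathConnected_compl_of_one_lt_rank
      (by rw [Complex.rank_real_complex]; norm_num)).isConnected.isPreconnected
  have hlarge : ∀ s : ℂ, 1 < ‖s‖ → s ∈ Bᶜ := by
    intro s hs
    refine (hmem s).2 ⟨fun h => by simp [h] at hs; linarith, fun I hI h i hi h0 => ?_⟩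
    have h1 : ‖(χ I h i)⁻¹ * s ^ (-(m I i))‖ = 1 := by
      rw [← sub_eq_zero.1 h0, norm_one]
    rw [norm_mul, norm_inv, hχ I hI h i hi, inv_one, one_mul, norm_zpow] at h1
    have h2 := (zpow_eq_one_iff_right₀ (norm_nonneg s) hs.ne').1 h1
    exact hm I hI i hi (neg_eq_zero.1 h2)
  have hdiff : DifferentiableOn ℂ (fun t : ℂ => ∑ I ∈ S, w I * ∑ h : H I, ∏ i ∈ I,
      (1 + y * (χ I h i)⁻¹ * t ^ (-(m I i))) / (1 - (χ I h i)⁻¹ * t ^ (-(m I i)))) Bᶜ := by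
    refine DifferentiableOn.fun_sum fun I hI => DifferentiableOn.const_mul
      (DifferentiableOn.fun_sum fun h _ => DifferentiableOn.fun_finsetProd fun i hi => ?_) _
    have hz : DifferentiableOn ℂ (fun t : ℂ => t ^ (-(m I i))) Bᶜ :=
      differentiableOn_zpow _ _ (Or.inl fun h => ((hmem 0).1 h).1 rfl)
    exact ((hz.const_mul _).const_add _).fun_div ((hz.const_mul _).const_sub _)
      fun s hs => ((hmem s).1 hs).2 I hI h i hi
  have h2 : (2 : ℂ) ∈ {s : ℂ | 1 < ‖s‖} := by simp
  have heq := (hdiff.analyticOnNhd hfin.isClosed.isOpen_compl).eqOn_of_preconnected_of_eventuallyEq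
    (analyticOnNhd_const (v := C)) hconn (hlarge 2 h2)
    (Filter.eventuallyEq_of_mem ((isOpen_lt continuous_const continuous_norm).mem_nhds h2)
      fun s hs => hC s hs)
  exact heq ((hmem t).2 ⟨ht, hden⟩)

/-- The Laurent coefficient at a nonzero character which is nonnegative on `x` vanishes. -/
theorem prod_laurentOffset_eq_zero {L : Type*} [AddCommGroup L] {κ : Type*} [Fintype κ]
    [DecidableEq κ] {b : κ → L} [Finite (L ⧸ Submodule.span ℤ (Set.range b))] {ub : κ → (L →ₗ[ℤ] ℚ)}
    (hdual : ∀ i j, ub i (b j) = if i = j then 1 else 0)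
    {x : L} (hx : ∀ i, ub i x ≠ 0) {R : Type*} [CommRing R] [Nontrivial R] (y : R)
    {u : L →ₗ[ℤ] ℤ} (hu : u ≠ 0) (hux : 0 ≤ u x) :
    ∏ i, (laurentOffset y (u (b i)) + if 0 < ub i x then 1 + y else 0) = 0 := by
  by_contra hne
  have hfac : ∀ i, laurentOffset y (u (b i)) + (if 0 < ub i x then 1 + y else 0) ≠ 0 :=
    fun i h => hne (Finset.prod_eq_zero (Finset.mem_univ i) h)
  have hle : ∀ i, (u (b i) : ℚ) * ub i x ≤ 0 := by
    intro i
    have h := hfac i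
    rcases (hx i).lt_or_gt with hi | hi
    · refine mul_nonpos_of_nonneg_of_nonpos ?_ hi.le
      by_contra hlt
      have hlt' : u (b i) < 0 := by exact_mod_cast not_le.1 hlt
      exact h (by simp [laurentOffset, hlt'.ne, not_lt.2 hlt'.le, not_lt.2 hi.le])
    · refine mul_nonpos_of_nonpos_of_nonneg ?_ hi.le
      by_contra hlt
      have hlt' : 0 < u (b i) := by exact_mod_cast not_le.1 hlt
      exact h (by simp [laurentOffset, hlt'.ne', hlt', hi])
  have hsum : (u x : ℚ) = ∑ i, (u (b i) : ℚ) * ub i x := by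
    simpa using dual_expand hdual ((Algebra.linearMap ℤ ℚ).comp u) x
  have hzero : ∑ i, (u (b i) : ℚ) * ub i x = 0 :=
    le_antisymm (Finset.sum_nonpos fun i _ => hle i) (hsum ▸ by exact_mod_cast hux)
  have hall := (Finset.sum_eq_zero_iff_of_nonpos fun i _ => hle i).1 hzero
  refine hu ?_
  have h0 := eq_zero_of_finite_quotient_span (b := b) (f := (Algebra.linearMap ℤ ℚ).comp u)
    fun i => by simpa [hx i] using hall i (Finset.mem_univ i)
  ext z
  simpa using LinearMap.congr_fun h0 z

/-- Rigidity and formula for the `T_y`-genus of a complete simplicial multi-fan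
`Δ = (Σ, C, w^±)` with edge vectors `𝒱`.  Data: top simplices `Sn`, weights `wt`,
dual bases `uI I i ∈ L_{I,𝒱}*` (`hdual`), completeness (`hcomplete`); `H I`
realizes the finite group `H_I = L/L_{I,𝒱}` (`hH`), and
`χ I h i = χ_I(u_i^I, h) = e^{2πi⟨u_i^I, v(h)⟩}` (`hχ`).  For a generic `vgen ∈ L_𝒱`
with integral coordinates `mm I i = ⟨u_i^I, vgen⟩` (`hmm`, `hgen`), set
`μ(I) = #{i ∈ I : mm I i > 0}` and `h_k(Δ) = Σ_{μ(I)=k} w(I)`.  Then the equivariant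
`T_y`-genus evaluated along `vgen` at any admissible `t`,
`Σ_I (w(I)/|H_I|) Σ_{h∈H_I} ∏_{i∈I} (1 + y χ_I(u_i^I,h)⁻¹ t^{-m_i})/(1 - χ_I(u_i^I,h)⁻¹ t^{-m_i})`,
is the constant `Σ_{k=0}^n h_k(Δ)(-y)^k`, and moreover `h_{n-k}(Δ) = h_k(Δ)`. -/
theorem Ty_genus_rigid
    {L : Type*} [AddCommGroup L] [Module.Free ℤ L] [Module.Finite ℤ L]
    {ι : Type*} [Fintype ι]
    (n : ℕ) (v : ι → L) (Sn : Finset (Finset ι)) (hSn : Sn.Nonempty)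
    (hcard : ∀ I ∈ Sn, I.card = n)
    (wt : Finset ι → ℤ)
    (uI : Finset ι → ι → (L →ₗ[ℤ] ℚ))
    (hdual : ∀ I ∈ Sn, ∀ i ∈ I, ∀ j ∈ I, uI I i (v j) = if i = j then 1 else 0)
    (hcomplete : ∀ K : Finset ι, (∃ I ∈ Sn, K ⊆ I) →
      ∃ d : ℤ, ∀ vg : L,
        (∀ I ∈ Sn, K ⊆ I → ∀ i ∈ I \ K, uI I i vg ≠ 0) →
        ∑ I ∈ Sn.filter (fun I => K ⊆ I ∧ ∀ i ∈ I \ K, 0 < uI I i vg), wt I = d)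
    (H : Finset ι → Type*) [∀ I, Fintype (H I)]
    (vrep : (I : Finset ι) → H I → L)
    (hH : ∀ I ∈ Sn, Function.Bijective fun h : H I =>
      (Submodule.Quotient.mk (vrep I h) : L ⧸ Submodule.span ℤ (v '' (I : Set ι))))
    (χ : (I : Finset ι) → H I → ι → ℂ)
    (hχ : ∀ I ∈ Sn, ∀ h : H I, ∀ i ∈ I,
      χ I h i = Complex.exp (2 * (Real.pi : ℂ) * Complex.I * ((uI I i (vrep I h) : ℚ) : ℂ)))
    (vgen : L) (mm : Finset ι → ι → ℤ)
    (hmm : ∀ I ∈ Sn, ∀ i ∈ I, uI I i vgen = (mm I i : ℚ))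
    (hgen : ∀ I ∈ Sn, ∀ i ∈ I, mm I i ≠ 0)
    (y t : ℂ) (ht : t ≠ 0)
    (hden : ∀ I ∈ Sn, ∀ h : H I, ∀ i ∈ I, 1 - (χ I h i)⁻¹ * t ^ (-(mm I i)) ≠ 0) :
    (∑ I ∈ Sn, ((wt I : ℂ) / (Fintype.card (H I) : ℂ)) *
        ∑ h : H I, ∏ i ∈ I,
          (1 + y * (χ I h i)⁻¹ * t ^ (-(mm I i))) /
            (1 - (χ I h i)⁻¹ * t ^ (-(mm I i)))) =
      ∑ k ∈ Finset.range (n + 1),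
        ((∑ I ∈ Sn.filter (fun I => (I.filter fun i => 0 < mm I i).card = k), wt I : ℤ) : ℂ) *
          (-y) ^ k ∧
    ∀ k ≤ n,
      (∑ I ∈ Sn.filter (fun I => (I.filter fun i => 0 < mm I i).card = n - k), wt I) =
        ∑ I ∈ Sn.filter (fun I => (I.filter fun i => 0 < mm I i).card = k), wt I := by
  have hrange : ∀ I : Finset ι, v '' (I : Set ι) = Set.range fun i : I => v i := fun I => by
    rw [Set.image_eq_range]
    rfl
  have hdual' : ∀ I ∈ Sn, ∀ i j : I, uI I i (v j) = if i = j then 1 else 0 := fun I hI i j => by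
    simp only [hdual I hI i i.2 j j.2, Subtype.ext_iff]
  have hH' : ∀ I ∈ Sn, Function.Bijective fun h : H I =>
      (Submodule.Quotient.mk (vrep I h) :
        L ⧸ Submodule.span ℤ (Set.range fun i : I => v i)) := fun I hI => by
    have := hH I hI
    rwa [hrange] at this
  have hpos : ∀ I ∈ Sn, ∀ i ∈ I, 0 < uI I i vgen ↔ 0 < mm I i := fun I hI i hi => by
    rw [hmm I hI i hi, Int.cast_pos]
  have hgen' : ∀ I ∈ Sn, ∀ i ∈ I, uI I i vgen ≠ 0 := fun I hI i hi => by
    rw [hmm I hI i hi]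
    exact_mod_cast hgen I hI i hi
  have hgen'' : ∀ I ∈ Sn, ∀ i ∈ I, uI I i (-vgen) ≠ 0 := fun I hI i hi => by
    rw [map_neg, neg_ne_zero]
    exact hgen' I hI i hi
  have hindep : ∀ {R : Type} [CommRing R] (y : R) (u : L →ₗ[ℤ] ℤ),
      ∑ I ∈ Sn, (wt I : R) *
        ∏ i ∈ I, (laurentOffset y (u (v i)) + if 0 < uI I i vgen then 1 + y else 0) =
      ∑ I ∈ Sn, (wt I : R) *
        ∏ i ∈ I, (laurentOffset y (u (v i)) + if 0 < uI I i (-vgen) then 1 + y else 0) :=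
    fun y u => sum_prod_add_indep (uI := fun I i x => uI I i x) hcard hcomplete
      (fun i => laurentOffset y (u (v i))) (1 + y) hgen' hgen''
  have hpow : ∀ {R : Type} [CommRing R] (y : R), ∀ I ∈ Sn,
      ∏ i ∈ I, (laurentOffset y ((0 : L →ₗ[ℤ] ℤ) (v i)) +
        if 0 < uI I i vgen then 1 + y else 0) =
      (-y) ^ (n - (I.filter fun i => 0 < mm I i).card) := by
    intro R _ y I hI
    have hc : n - (I.filter fun i => 0 < mm I i).card =
        (I.filter fun i => ¬ 0 < mm I i).card := by
      have := Finset.card_filter_add_card_filter_not (s := I) (fun i => 0 < mm I i)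
      rw [hcard I hI] at this
      omega
    rw [hc, ← Finset.prod_const, Finset.prod_filter]
    refine Finset.prod_congr rfl fun i hi => ?_
    by_cases h : 0 < mm I i <;> simp [laurentOffset, hpos I hI i hi, h]
  have hpow' : ∀ {R : Type} [CommRing R] (y : R), ∀ I ∈ Sn,
      ∏ i ∈ I, (laurentOffset y ((0 : L →ₗ[ℤ] ℤ) (v i)) +
        if 0 < uI I i (-vgen) then 1 + y else 0) =
      (-y) ^ (I.filter fun i => 0 < mm I i).card := by
    intro R _ y I hI
    rw [← Finset.prod_const, Finset.prod_filter]
    refine Finset.prod_congr rfl fun i hi => ?_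
    rcases (hgen I hI i hi).lt_or_gt with h | h
    · simp [laurentOffset, hmm I hI i hi, h, h.not_gt]
    · simp [laurentOffset, hmm I hI i hi, h, h.not_gt]
  have hle : ∀ I ∈ Sn, (I.filter fun i => 0 < mm I i).card ≤ n := fun I hI =>
    hcard I hI ▸ Finset.card_filter_le _ _
  have hvanish : ∀ u : L →ₗ[ℤ] ℤ, u ≠ 0 → ∑ I ∈ Sn, (wt I : ℂ) *
      ∏ i ∈ I, (laurentOffset y (u (v i)) + if 0 < uI I i vgen then 1 + y else 0) = 0 := by
    have hnonneg : ∀ (u : L →ₗ[ℤ] ℤ), u ≠ 0 → ∀ x : L, (∀ I ∈ Sn, ∀ i ∈ I, uI I i x ≠ 0) →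
        0 ≤ u x → ∑ I ∈ Sn, (wt I : ℂ) *
          ∏ i ∈ I, (laurentOffset y (u (v i)) + if 0 < uI I i x then 1 + y else 0) = 0 := by
      intro u hu x hx hux
      refine Finset.sum_eq_zero fun I hI => ?_
      have := finite_quotient_of_bijective (hH' I hI)
      have h0 := prod_laurentOffset_eq_zero (hdual' I hI) (fun i => hx I hI i i.2) y hu hux
      rw [Finset.prod_coe_sort I fun i =>
        laurentOffset y (u (v i)) + if 0 < uI I i x then 1 + y else 0] at h0
      rw [h0, mul_zero]
    intro u hu
    rcases le_total 0 (u vgen) with h | h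
    · exact hnonneg u hu vgen hgen' h
    · rw [hindep]
      exact hnonneg u hu (-vgen) hgen'' (by rw [map_neg]; exact neg_nonneg.2 h)
  have hfiber : ∑ I ∈ Sn, (wt I : ℂ) * (-y) ^ (I.filter fun i => 0 < mm I i).card =
      ∑ k ∈ Finset.range (n + 1),
        ((∑ I ∈ Sn.filter (fun I => (I.filter fun i => 0 < mm I i).card = k), wt I : ℤ) : ℂ) *
          (-y) ^ k := by
    rw [← Finset.sum_fiberwise_of_maps_to (t := Finset.range (n + 1))
      fun I hI => Finset.mem_range.2 (Nat.lt_succ_of_le (hle I hI))]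
    refine Finset.sum_congr rfl fun k _ => ?_
    rw [Int.cast_sum, Finset.sum_mul]
    refine Finset.sum_congr rfl fun I hI => ?_
    rw [(Finset.mem_filter.1 hI).2]
  refine ⟨?_, ?_⟩
  · rw [← hfiber]
    refine sum_cone_eq_of_one_lt_norm (fun I => (wt I : ℂ) / (Fintype.card (H I) : ℂ)) ?_ hgen y _
      ?_ ht hden
    · intro I hI h i hi
      have : 2 * (Real.pi : ℂ) * Complex.I * ((uI I i (vrep I h) : ℚ) : ℂ) =
          ((2 * Real.pi * (uI I i (vrep I h) : ℚ) : ℝ) : ℂ) * Complex.I := by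
        push_cast
        ring
      rw [hχ I hI h i hi, this, Complex.norm_exp_ofReal_mul_I]
    intro s hs
    have hcone : ∀ I ∈ Sn, HasSum (fun u : L →ₗ[ℤ] ℤ => (wt I : ℂ) *
        ((∏ i ∈ I, (laurentOffset y (u (v i)) + if 0 < uI I i vgen then 1 + y else 0)) *
          s ^ u vgen))
        ((wt I : ℂ) / (Fintype.card (H I) : ℂ) * ∑ h : H I, ∏ i ∈ I,
          (1 + y * (χ I h i)⁻¹ * s ^ (-(mm I i))) / (1 - (χ I h i)⁻¹ * s ^ (-(mm I i)))) := by
      intro I hI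
      have h := (hasSum_cone (hdual' I hI) (hH' I hI) (χ := fun h i => χ I h i)
        (fun h i => hχ I hI h i i.2) (fun i => hmm I hI i i.2) (fun i => hgen I hI i i.2)
        y hs).mul_left (wt I : ℂ)
      rw [← mul_assoc, ← div_eq_mul_inv] at h
      rw [Finset.sum_congr rfl fun h' _ => Finset.prod_coe_sort I fun i =>
        (1 + y * (χ I h' i)⁻¹ * s ^ (-(mm I i))) / (1 - (χ I h' i)⁻¹ * s ^ (-(mm I i)))] at h
      refine h.congr_fun fun u => ?_
      rw [Finset.prod_congr rfl fun i hi => congrArg _ (if_congr (hpos I hI i hi) rfl rfl),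
        ← Finset.prod_coe_sort]
    have hsum := hasSum_sum hcone
    refine hsum.unique ?_
    have hzero := hasSum_ite_eq (0 : L →ₗ[ℤ] ℤ)
      (∑ I ∈ Sn, (wt I : ℂ) * (-y) ^ (I.filter fun i => 0 < mm I i).card)
    refine hzero.congr_fun fun u => ?_
    simp only [← mul_assoc]
    rw [← Finset.sum_mul]
    split_ifs with hu
    · rw [hu, hindep, LinearMap.zero_apply, zpow_zero, mul_one]
      exact Finset.sum_congr rfl fun I hI => by rw [hpow' y I hI]
    · rw [hvanish u hu, zero_mul]
  · intro k hk
    have h := hindep (-Polynomial.X : Polynomial ℤ) 0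
    rw [Finset.sum_congr rfl fun I hI => congrArg _ (hpow _ I hI),
      Finset.sum_congr rfl fun I hI => congrArg _ (hpow' _ I hI)] at h
    have hcoef := congrArg (fun p => Polynomial.coeff p k) h
    simp only [neg_neg, Polynomial.finsetSum_coeff, ← Polynomial.C_eq_intCast, Int.cast_id,
      Polynomial.coeff_C_mul, Polynomial.coeff_X_pow, mul_ite, mul_one, mul_zero] at hcoef
    rw [Finset.sum_filter, Finset.sum_filter]
    refine Eq.trans (Finset.sum_congr rfl fun I hI => ?_)
      (hcoef.trans (Finset.sum_congr rfl fun I hI => ?_))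
    · have := hle I hI
      exact if_congr (by omega) rfl rfl
    · exact if_congr eq_comm rfl rfl
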